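/- arXiv:1703.06149 — 2 statements merged into one kernel-verified Lean document; each statement's English description precedes it below -/
import Mathlib

section
/- Let γ_AB = [[γ_A, X],[Xᵀ, γ_B]] be a pure quantum covariance matrix on n + n modes (with n_A = n_B = n, relative to the partition of the phase-space coordinates into the A and B subsystems), and suppose the complex Hermitian matrix γ_A + iΩ_n is positive definite. Then the Schur complement of γ_AB + iΩ_{AB} with respect to γ_A + iΩ_n vanishes: γ_B + iΩ_n − Xᵀ (γ_A + iΩ_n)⁻¹ X = 0. -/
open Matrix
open scoped ComplexOrder

/-- The standard symplectic form on `n` modes. -/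
def Omg (n : ℕ) : Matrix (Fin n ⊕ Fin n) (Fin n ⊕ Fin n) ℝ :=
  fromBlocks 0 1 (-1) 0

/-- A real matrix is symplectic (with respect to a given form `Ω`) if `S Ω Sᵀ = Ω`. -/
def IsSymplectic {N : Type*} [Fintype N] (Ω S : Matrix N N ℝ) : Prop :=
  S * Ω * Sᵀ = Ω

/-- Complexification of a real matrix. -/
noncomputable def cplx {μ ν : Type*} (M : Matrix μ ν ℝ) : Matrix μ ν ℂ :=
  M.map (fun x => (x : ℂ))

/-- A pure quantum covariance matrix: `V = S Sᵀ` with `S` symplectic. -/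
def IsPureQCM {N : Type*} [Fintype N] (Ω V : Matrix N N ℝ) : Prop :=
  ∃ S, IsSymplectic Ω S ∧ V = S * Sᵀ

theorem cplx_mul {l m k : Type*} [Fintype m] (M : Matrix l m ℝ) (N : Matrix m k ℝ) :
    cplx (M * N) = cplx M * cplx N :=
  Matrix.map_mul (f := Complex.ofRealHom)

/-- The Schur complement of an invertible block vanishes when the block matrix factors through
a space of the same dimension as that block. -/
theorem schur_complement_eq_zero_of_factor {m l : Type*} [Fintype m] [DecidableEq m]
    {K : Type*} [Field K] (K₁ L₁ : Matrix m m K) (K₂ : Matrix l m K) (L₂ : Matrix m l K)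
    (h : IsUnit (K₁ * L₁)) :
    K₂ * L₂ - K₂ * L₁ * (K₁ * L₁)⁻¹ * (K₁ * L₂) = 0 := by
  rw [isUnit_iff_isUnit_det, det_mul, IsUnit.mul_iff] at h
  rw [Matrix.mul_inv_rev, sub_eq_zero]
  simp only [Matrix.mul_assoc]
  rw [nonsing_inv_mul_cancel_left _ _ h.1, mul_nonsing_inv_cancel_left _ _ h.2]

/-- The vacuum matrix `1 + iΩ` has rank at most half its size, by an explicit factorization. -/
theorem one_add_I_smul_cplx_Omg (n : ℕ) :
    (1 : Matrix (Fin n ⊕ Fin n) (Fin n ⊕ Fin n) ℂ) + Complex.I • cplx (Omg n) =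
      fromRows (1 : Matrix (Fin n) (Fin n) ℂ) (-Complex.I • 1) *
        fromCols (1 : Matrix (Fin n) (Fin n) ℂ) (Complex.I • 1) := by
  rw [fromRows_mul_fromCols, ← fromBlocks_one]
  ext (i | i) (j | j) <;>
    simp [cplx, Omg, Matrix.one_apply, apply_ite (Complex.ofReal), smul_smul]

/-- for a pure QCM `γ_AB` on `n + n` modes with `γ_A + iΩ_n` positive
definite, the Schur complement of `γ_AB + iΩ_AB` with respect to `γ_A + iΩ_n` vanishes:
`γ_B + iΩ_n − Xᵀ (γ_A + iΩ_n)⁻¹ X = 0`. -/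
theorem stmt14 {n : ℕ}
    (γ : Matrix ((Fin n ⊕ Fin n) ⊕ (Fin n ⊕ Fin n))
      ((Fin n ⊕ Fin n) ⊕ (Fin n ⊕ Fin n)) ℝ)
    (hγ : IsPureQCM (fromBlocks (Omg n) 0 0 (Omg n)) γ)
    (hγA : (cplx γ.toBlocks₁₁ + Complex.I • cplx (Omg n)).PosDef) :
    cplx γ.toBlocks₂₂ + Complex.I • cplx (Omg n) -
        (cplx γ.toBlocks₁₂)ᵀ *
          (cplx γ.toBlocks₁₁ + Complex.I • cplx (Omg n))⁻¹ *
            cplx γ.toBlocks₁₂ = 0 := by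
  obtain ⟨S, hS, rfl⟩ := hγ
  set W := fromRows (1 : Matrix (Fin n) (Fin n) ℂ)
    (-Complex.I • (1 : Matrix (Fin n) (Fin n) ℂ)) with hW
  set Z := fromCols (1 : Matrix (Fin n) (Fin n) ℂ)
    (Complex.I • (1 : Matrix (Fin n) (Fin n) ℂ)) with hZ
  have hP : (1 : Matrix _ _ ℂ) + Complex.I • cplx (fromBlocks (Omg n) 0 0 (Omg n)) =
      fromBlocks W 0 0 W * fromBlocks Z 0 0 Z := by
    rw [fromBlocks_multiply]
    simp only [Matrix.mul_zero, Matrix.zero_mul, add_zero, zero_add, hW, hZ,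
      ← one_add_I_smul_cplx_Omg]
    ext (i | i) (j | j) <;> simp [cplx, Matrix.one_apply]
  have hM : cplx (S * Sᵀ) + Complex.I • cplx (fromBlocks (Omg n) 0 0 (Omg n)) =
      (cplx S * fromBlocks W 0 0 W) * (fromBlocks Z 0 0 Z * cplx Sᵀ) := by
    calc _ = cplx (S * Sᵀ) + Complex.I • cplx (S * fromBlocks (Omg n) 0 0 (Omg n) * Sᵀ) := by
          rw [show S * fromBlocks (Omg n) 0 0 (Omg n) * Sᵀ = _ from hS]
      _ = cplx S * (1 + Complex.I • cplx (fromBlocks (Omg n) 0 0 (Omg n))) * cplx Sᵀ := by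
          simp [cplx_mul, Matrix.mul_add, Matrix.add_mul]
      _ = _ := by rw [hP]; simp only [Matrix.mul_assoc]
  have hX : (cplx (S * Sᵀ).toBlocks₁₂)ᵀ = cplx (S * Sᵀ).toBlocks₂₁ := by
    ext i j
    have h : (S * Sᵀ)ᵀ = S * Sᵀ := by simp
    exact congrArg Complex.ofReal (congrFun₂ h (Sum.inr i) (Sum.inl j))
  generalize cplx S * fromBlocks W 0 0 W = K at hM
  generalize fromBlocks Z 0 0 Z * cplx Sᵀ = L at hM
  rw [← fromRows_toRows K, ← fromCols_toCols L, fromRows_mul_fromCols] at hM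
  have h₁₁ : cplx (S * Sᵀ).toBlocks₁₁ + Complex.I • cplx (Omg n) = K.toRows₁ * L.toCols₁ := by
    ext i j
    simpa [cplx, toBlocks₁₁] using congrFun₂ hM (Sum.inl i) (Sum.inl j)
  have h₁₂ : cplx (S * Sᵀ).toBlocks₁₂ = K.toRows₁ * L.toCols₂ := by
    ext i j
    simpa [cplx, toBlocks₁₂] using congrFun₂ hM (Sum.inl i) (Sum.inr j)
  have h₂₁ : cplx (S * Sᵀ).toBlocks₂₁ = K.toRows₂ * L.toCols₁ := by
    ext i j
    simpa [cplx, toBlocks₂₁] using congrFun₂ hM (Sum.inr i) (Sum.inl j)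
  have h₂₂ : cplx (S * Sᵀ).toBlocks₂₂ + Complex.I • cplx (Omg n) = K.toRows₂ * L.toCols₂ := by
    ext i j
    simpa [cplx, toBlocks₂₂] using congrFun₂ hM (Sum.inr i) (Sum.inr j)
  rw [hX, h₁₁, h₁₂, h₂₁, h₂₂]
  exact schur_complement_eq_zero_of_factor _ _ _ _ (h₁₁ ▸ hγA.isUnit)
end

section
/- Let γ_RC = [[V_R, L],[Lᵀ, γ_C]] be a pure quantum covariance matrix on n + n modes (with n_R = n_C = n), such that the complex Hermitian matrix V_R − iΩ_n is positive definite. Let τ_R be a pure quantum covariance matrix on n modes with V_R − τ_R positive definite. Then: the off-diagonal block L is invertible; the matrix σ_C := Lᵀ (V_R − τ_R)⁻¹ L − γ_C is a pure quantum covariance matrix; and the Schur complement identity V_R − L (γ_C + σ_C)⁻¹ Lᵀ = τ_R holds (i.e. the Gaussian measurement on C with pure seed σ_C collapses the purification onto τ_R). -/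
open Matrix
open scoped ComplexOrder

section FormMatrices

variable {N : Type*} [Fintype N] [DecidableEq N]

lemma IsSymplectic.mul_neg_form {Ω S : Matrix N N ℝ} (hΩ : Ω * Ω = -1)
    (hS : IsSymplectic Ω S) : S * (-(Ω * Sᵀ * Ω)) = 1 := by
  calc S * (-(Ω * Sᵀ * Ω)) = -((S * Ω * Sᵀ) * Ω) := by noncomm_ring
    _ = 1 := by rw [hS, hΩ, neg_neg]

lemma IsSymplectic.transpose {Ω S : Matrix N N ℝ} (hΩ : Ω * Ω = -1) (hS : IsSymplectic Ω S) :
    Sᵀ * Ω * S = Ω := by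
  calc Sᵀ * Ω * S = -((Ω * Ω) * (Sᵀ * Ω * S)) := by rw [hΩ]; noncomm_ring
    _ = Ω * ((-(Ω * Sᵀ * Ω)) * S) := by noncomm_ring
    _ = Ω := by rw [mul_eq_one_comm.mp (hS.mul_neg_form hΩ), mul_one]

lemma IsSymplectic.isUnit {Ω S : Matrix N N ℝ} (hΩ : Ω * Ω = -1) (hS : IsSymplectic Ω S) :
    IsUnit S :=
  IsUnit.of_mul_eq_one _ (hS.mul_neg_form hΩ)

lemma IsPureQCM.mul_form_mul_self {Ω V : Matrix N N ℝ} (hΩ : Ω * Ω = -1)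
    (hV : IsPureQCM Ω V) : V * Ω * V = Ω := by
  obtain ⟨S, hS, rfl⟩ := hV
  calc S * Sᵀ * Ω * (S * Sᵀ) = S * (Sᵀ * Ω * S) * Sᵀ := by noncomm_ring
    _ = Ω := by rw [hS.transpose hΩ, hS]

lemma IsPureQCM.posDef {Ω V : Matrix N N ℝ} (hΩ : Ω * Ω = -1) (hV : IsPureQCM Ω V) :
    V.PosDef := by
  obtain ⟨S, hS, rfl⟩ := hV
  rw [← conjTranspose_eq_transpose_of_trivial]
  exact PosDef.mul_conjTranspose_self S (vecMul_injective_of_isUnit (hS.isUnit hΩ))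

open scoped MatrixOrder in
/-- A positive definite `V` with `V Ω V = Ω` is pure: its square root is symplectic. -/
lemma IsPureQCM.of_posDef {Ω V : Matrix N N ℝ} (hΩ : Ω * Ω = -1) (hΩt : Ωᵀ = -Ω)
    (hV : V.PosDef) (h : V * Ω * V = Ω) : IsPureQCM Ω V := by
  set r := CFC.sqrt V with hr
  have hrV : r * r = V := CFC.sqrt_mul_sqrt_self V hV.posSemidef.nonneg
  have hrp : r.PosSemidef := (CFC.sqrt_nonneg V).posSemidef
  have hrt : rᵀ = r := by
    rw [← conjTranspose_eq_transpose_of_trivial]; exact hrp.isHermitian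
  have hru : IsUnit r.det := by
    have h1 : IsUnit (r * r).det := by
      rw [hrV]; exact (isUnit_iff_isUnit_det V).mp hV.isUnit
    rw [det_mul] at h1
    exact isUnit_of_mul_isUnit_left h1
  have hVinv : V⁻¹ = -(Ω * V * Ω) := by
    refine inv_eq_right_inv ?_
    calc V * (-(Ω * V * Ω)) = -((V * Ω * V) * Ω) := by noncomm_ring
      _ = 1 := by rw [h, hΩ, neg_neg]
  have hpos : (Ω * r * Ωᵀ).PosSemidef := by
    rw [← conjTranspose_eq_transpose_of_trivial]
    exact hrp.mul_mul_conjTranspose_same Ω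
  have hsq : (Ω * r * Ωᵀ) * (Ω * r * Ωᵀ) = V⁻¹ := by
    rw [hVinv, hΩt, ← hrV]
    calc Ω * r * -Ω * (Ω * r * -Ω) = Ω * r * (Ω * Ω) * r * Ω := by noncomm_ring
      _ = -(Ω * (r * r) * Ω) := by rw [hΩ]; noncomm_ring
  have hrinv : r⁻¹ = Ω * r * Ωᵀ := by
    rw [hr, hV.posSemidef.inv_sqrt, ← hr]
    exact CFC.sqrt_unique hsq hpos.nonneg
  refine ⟨r, ?_, by rw [hrt, hrV]⟩
  have h1 : r * (Ω * r * Ωᵀ) = 1 := by rw [← hrinv, mul_nonsing_inv r hru]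
  rw [IsSymplectic, hrt]
  calc r * Ω * r = -(r * Ω * r * (Ω * Ω)) := by rw [hΩ]; noncomm_ring
    _ = (r * (Ω * r * Ωᵀ)) * Ω := by rw [hΩt]; noncomm_ring
    _ = Ω := by rw [h1, one_mul]

end FormMatrices

/-- Matrix inversion is strictly antitone on positive definite matrices. -/
lemma Matrix.PosDef.inv_sub_inv {N : Type*} [Fintype N] [DecidableEq N] {A B : Matrix N N ℝ}
    (hA : A.PosDef) (hBA : (B - A).PosDef) : (A⁻¹ - B⁻¹).PosDef := by
  have hB : B.PosDef := by simpa using hA.add hBA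
  have uA := (isUnit_iff_isUnit_det A).mp hA.isUnit
  have uB := (isUnit_iff_isUnit_det B).mp hB.isUnit
  set D := B - A with hD
  have uD := (isUnit_iff_isUnit_det D).mp hBA.isUnit
  have hE : (A + A * D⁻¹ * A).PosDef := by
    have h := hBA.inv.posSemidef.mul_mul_conjTranspose_same A
    rw [hA.isHermitian.eq] at h
    exact hA.add_posSemidef h
  have key : (A + A * D⁻¹ * A)⁻¹ = A⁻¹ - B⁻¹ := by
    have hE' : A + A * D⁻¹ * A = B * D⁻¹ * A := by
      have : B = D + A := by simp [hD]
      rw [this, add_mul, mul_nonsing_inv D uD, add_mul, one_mul]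
    rw [hE', mul_inv_rev, mul_inv_rev, nonsing_inv_nonsing_inv D uD, hD, sub_mul,
      mul_nonsing_inv B uB, mul_sub, mul_one, ← mul_assoc, nonsing_inv_mul A uA, one_mul]
  rw [← key]
  exact hE.inv

lemma Omg_mul_self (n : ℕ) : Omg n * Omg n = -1 := by
  simp [Omg, fromBlocks_multiply, ← fromBlocks_one, fromBlocks_neg]

lemma Omg_transpose (n : ℕ) : (Omg n)ᵀ = -Omg n := by
  simp [Omg, fromBlocks_transpose, fromBlocks_neg]

section Purification

variable {N : Type*} [Fintype N] [DecidableEq N] {Ω V L C τ : Matrix N N ℝ}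

/-- The Schur-type formula for the purifying block `C` of a pure QCM `[[V, L], [Lᵀ, C]]`,
together with invertibility of the correlation block `L`. -/
lemma purification_block (hΩ : Ω * Ω = -1) (hV : IsUnit V) (hK : IsUnit (V + Ω * V⁻¹ * Ω))
    (h₁ : V * Ω * V + L * Ω * Lᵀ = Ω) (h₂ : V * Ω * L + L * Ω * C = 0) :
    IsUnit L ∧ Lᵀ * (V + Ω * V⁻¹ * Ω)⁻¹ * L = C := by
  have uV := (isUnit_iff_isUnit_det V).mp hV
  have uK := (isUnit_iff_isUnit_det _).mp hK
  set K := V + Ω * V⁻¹ * Ω with hKdef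
  have hVV : V⁻¹ * V = 1 := nonsing_inv_mul V uV
  have hKL : Ω * V⁻¹ * L * Ω * Lᵀ = K := by
    calc Ω * V⁻¹ * L * Ω * Lᵀ = Ω * V⁻¹ * (L * Ω * Lᵀ) := by noncomm_ring
      _ = Ω * V⁻¹ * (Ω - V * Ω * V) := by rw [← eq_sub_of_add_eq' h₁]
      _ = Ω * V⁻¹ * Ω - Ω * (V⁻¹ * V) * Ω * V := by noncomm_ring
      _ = Ω * V⁻¹ * Ω - (Ω * Ω) * V := by rw [hVV, mul_one]
      _ = K := by rw [hΩ, hKdef]; noncomm_ring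
  have hinv : (Ω * V⁻¹ * L * Ω) * (Lᵀ * K⁻¹) = 1 := by
    rw [← mul_assoc, hKL, mul_nonsing_inv K uK]
  have hinv' := mul_eq_one_comm.mp hinv
  have hC : Ω * V⁻¹ * L * Ω * C = L := by
    calc Ω * V⁻¹ * L * Ω * C = Ω * V⁻¹ * (L * Ω * C) := by noncomm_ring
      _ = Ω * V⁻¹ * (-(V * Ω * L)) := by rw [eq_neg_of_add_eq_zero_right h₂]
      _ = -(Ω * (V⁻¹ * V) * Ω * L) := by noncomm_ring
      _ = L := by rw [hVV, mul_one, hΩ]; noncomm_ring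
  constructor
  · rw [← isUnit_transpose]
    refine IsUnit.of_mul_eq_one (K⁻¹ * (Ω * V⁻¹ * L * Ω)) ?_
    rw [← mul_assoc, hinv']
  · calc Lᵀ * K⁻¹ * L = Lᵀ * K⁻¹ * (Ω * V⁻¹ * L * Ω * C) := by rw [hC]
      _ = (Lᵀ * K⁻¹ * (Ω * V⁻¹ * L * Ω)) * C := by noncomm_ring
      _ = C := by rw [hinv', one_mul]

/-- The measurement seed satisfies the quadratic identity characterising purity. -/
lemma seed_mul_form_mul_seed (hW : IsUnit (V - τ)) (hτ : τ * Ω * τ = Ω)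
    (h₁ : V * Ω * V + L * Ω * Lᵀ = Ω) (h₂ : V * Ω * L + L * Ω * C = 0)
    (h₃ : Lᵀ * Ω * V + C * Ω * Lᵀ = 0) (h₄ : Lᵀ * Ω * L + C * Ω * C = Ω) :
    (Lᵀ * (V - τ)⁻¹ * L - C) * Ω * (Lᵀ * (V - τ)⁻¹ * L - C) = Ω := by
  have uW := (isUnit_iff_isUnit_det _).mp hW
  have hPV : (V - τ)⁻¹ * V = 1 + (V - τ)⁻¹ * τ := by
    rw [← nonsing_inv_mul _ uW]; noncomm_ring
  have hVP : V * (V - τ)⁻¹ = 1 + τ * (V - τ)⁻¹ := by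
    rw [← mul_nonsing_inv _ uW]; noncomm_ring
  generalize (V - τ)⁻¹ = P at hPV hVP ⊢
  have bracket : P * Ω * P - (P * V) * Ω * (V * P) + (P * V) * Ω + Ω * (V * P) - Ω = 0 := by
    calc P * Ω * P - (P * V) * Ω * (V * P) + (P * V) * Ω + Ω * (V * P) - Ω
        = P * Ω * P - P * (τ * Ω * τ) * P := by rw [hPV, hVP]; noncomm_ring
      _ = 0 := by rw [hτ, sub_self]
  calc (Lᵀ * P * L - C) * Ω * (Lᵀ * P * L - C)
      = Lᵀ * P * (L * Ω * Lᵀ) * P * L - Lᵀ * P * (L * Ω * C) - (C * Ω * Lᵀ) * P * L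
        + C * Ω * C := by noncomm_ring
    _ = Lᵀ * P * (Ω - V * Ω * V) * P * L - Lᵀ * P * (-(V * Ω * L))
        - (-(Lᵀ * Ω * V)) * P * L + (Ω - Lᵀ * Ω * L) := by
      rw [← eq_sub_of_add_eq' h₁, ← eq_neg_of_add_eq_zero_right h₂,
        ← eq_neg_of_add_eq_zero_right h₃, ← eq_sub_of_add_eq' h₄]
    _ = Lᵀ * (P * Ω * P - (P * V) * Ω * (V * P) + (P * V) * Ω + Ω * (V * P) - Ω) * L + Ω := by
      noncomm_ring
    _ = Ω := by rw [bracket]; simp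

end Purification

/-- if `γ_RC = [[V_R, L],[Lᵀ, γ_C]]` is a pure QCM on `n + n` modes with
`V_R − iΩ_n` (complex) positive definite, and `τ_R` is a pure QCM with `V_R − τ_R`
positive definite, then `L` is invertible, `σ_C = Lᵀ (V_R − τ_R)⁻¹ L − γ_C` is a pure
QCM, and `V_R − L (γ_C + σ_C)⁻¹ Lᵀ = τ_R`. -/
theorem stmt15 {n : ℕ}
    (γ : Matrix ((Fin n ⊕ Fin n) ⊕ (Fin n ⊕ Fin n))
      ((Fin n ⊕ Fin n) ⊕ (Fin n ⊕ Fin n)) ℝ)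
    (hγ : IsPureQCM (fromBlocks (Omg n) 0 0 (Omg n)) γ)
    (VR : Matrix (Fin n ⊕ Fin n) (Fin n ⊕ Fin n) ℝ) (hVR : VR = γ.toBlocks₁₁)
    (L : Matrix (Fin n ⊕ Fin n) (Fin n ⊕ Fin n) ℝ) (hL : L = γ.toBlocks₁₂)
    (γC : Matrix (Fin n ⊕ Fin n) (Fin n ⊕ Fin n) ℝ) (hγC : γC = γ.toBlocks₂₂)
    (hVRi : (cplx VR - Complex.I • cplx (Omg n)).PosDef)
    (τ : Matrix (Fin n ⊕ Fin n) (Fin n ⊕ Fin n) ℝ)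
    (hτ : IsPureQCM (Omg n) τ)
    (hVRτ : (VR - τ).PosDef) :
    IsUnit L ∧
      IsPureQCM (Omg n) (Lᵀ * (VR - τ)⁻¹ * L - γC) ∧
        VR - L * (γC + (Lᵀ * (VR - τ)⁻¹ * L - γC))⁻¹ * Lᵀ = τ := by
  have hΩ := Omg_mul_self n
  have hΩt := Omg_transpose n
  have hΩ₂ : fromBlocks (Omg n) 0 0 (Omg n) * fromBlocks (Omg n) 0 0 (Omg n) = -1 := by
    simp [fromBlocks_multiply, hΩ, ← fromBlocks_one, fromBlocks_neg]
  have hγpos := hγ.posDef hΩ₂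
  have hγt : γᵀ = γ := by
    rw [← conjTranspose_eq_transpose_of_trivial]; exact hγpos.isHermitian
  have hblock : γ = fromBlocks VR L Lᵀ γC := by
    have h₂₁ : γ.toBlocks₂₁ = Lᵀ := by
      rw [hL]; nth_rewrite 1 [← hγt]; rfl
    rw [hVR, hL, hγC, ← hL, ← h₂₁, hL, fromBlocks_toBlocks]
  have hquad := hγ.mul_form_mul_self hΩ₂
  rw [hblock, fromBlocks_multiply, fromBlocks_multiply, fromBlocks_inj] at hquad
  simp only [mul_zero, add_zero, zero_add] at hquad
  obtain ⟨h₁, h₂, h₃, h₄⟩ := hquad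
  have hτpos := hτ.posDef hΩ
  have hτq := hτ.mul_form_mul_self hΩ
  have hVpos : VR.PosDef := by simpa using hτpos.add hVRτ
  -- `τ - Ωᵀ VR⁻¹ Ω = Ωᵀ (τ⁻¹ - VR⁻¹) Ω` is positive definite.
  have hτinv : Omg n * τ⁻¹ * Omg n = -τ := by
    have : τ⁻¹ = -(Omg n * τ * Omg n) := by
      refine inv_eq_right_inv ?_
      calc τ * (-(Omg n * τ * Omg n)) = -((τ * Omg n * τ) * Omg n) := by noncomm_ring
        _ = 1 := by rw [hτq, hΩ, neg_neg]
    rw [this]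
    calc Omg n * -(Omg n * τ * Omg n) * Omg n = -((Omg n * Omg n) * τ * (Omg n * Omg n)) := by
          noncomm_ring
      _ = -τ := by rw [hΩ]; noncomm_ring
  have hdiff : (τ + Omg n * VR⁻¹ * Omg n).PosDef := by
    have hΩinj : Function.Injective (Omg n).vecMul := vecMul_injective_of_isUnit
      (IsUnit.of_mul_eq_one (-Omg n) (by rw [mul_neg, hΩ, neg_neg]))
    have h := (hτpos.inv_sub_inv hVRτ).mul_mul_conjTranspose_same hΩinj
    rw [conjTranspose_eq_transpose_of_trivial, hΩt] at h
    have heq : Omg n * (τ⁻¹ - VR⁻¹) * -Omg n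
        = -(Omg n * τ⁻¹ * Omg n) + Omg n * VR⁻¹ * Omg n := by noncomm_ring
    rwa [heq, hτinv, neg_neg] at h
  have hKW : (VR + Omg n * VR⁻¹ * Omg n - (VR - τ)).PosDef := by
    convert hdiff using 1; abel
  have hK : (VR + Omg n * VR⁻¹ * Omg n).PosDef := by simpa using hVRτ.add hKW
  obtain ⟨hLu, hCeq⟩ := purification_block hΩ hVpos.isUnit hK.isUnit h₁ h₂
  have uL := (isUnit_iff_isUnit_det L).mp hLu
  have uLt : IsUnit Lᵀ.det := by rwa [det_transpose]
  have uW := (isUnit_iff_isUnit_det _).mp hVRτ.isUnit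
  refine ⟨hLu, IsPureQCM.of_posDef hΩ hΩt ?_
    (seed_mul_form_mul_seed hVRτ.isUnit hτq h₁ h₂ h₃ h₄), ?_⟩
  · have h := (hVRτ.inv_sub_inv hKW).conjTranspose_mul_mul_same
      (mulVec_injective_of_isUnit hLu)
    rwa [conjTranspose_eq_transpose_of_trivial, mul_sub, sub_mul, hCeq] at h
  · rw [add_sub_cancel, Matrix.mul_inv_rev, Matrix.mul_inv_rev, nonsing_inv_nonsing_inv _ uW, ← mul_assoc,
      mul_nonsing_inv L uL, one_mul, mul_assoc, nonsing_inv_mul _ uLt, mul_one, sub_sub_cancel]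
end
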